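/- arXiv:1712.08150 — 5 statements merged into one kernel-verified Lean document; each statement's English description precedes it below -/
import Mathlib

section
/- For every p ∈ S^m and every R ∈ (0, π/2), the map ξ_{p, tan R} sends the punctured geodesic ball B_{2R}(p) \ {p} bijectively onto the punctured open hemisphere {x ∈ S^m : ⟨x,p⟩ > 0} \ {p} centred at p. -/
open Real
open scoped RealInnerProductSpace

/-- Stereographic projection from the point `p` of the unit sphere `S^m ⊆ ℝ^{m+1}`
onto the hyperplane `L_p = {x | ⟪x,p⟫ = 0}`:  `φ_p(q) = (q − ⟪q,p⟫p)/(1 − ⟪q,p⟫)`. -/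
noncomputable def stereoProj {m : ℕ} (p q : EuclideanSpace ℝ (Fin (m + 1))) :
    EuclideanSpace ℝ (Fin (m + 1)) :=
  (1 - ⟪q, p⟫)⁻¹ • (q - ⟪q, p⟫ • p)

/-- The inverse of the stereographic projection `φ_p`:
`v ↦ ((‖v‖² − 1)p + 2v)/(‖v‖² + 1)`. -/
noncomputable def stereoInvFormula {m : ℕ} (p v : EuclideanSpace ℝ (Fin (m + 1))) :
    EuclideanSpace ℝ (Fin (m + 1)) :=
  (‖v‖ ^ 2 + 1)⁻¹ • ((‖v‖ ^ 2 - 1) • p + (2 : ℝ) • v)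

/-- The conformal transformation `ξ_{p,t} = φ_p⁻¹ ∘ s_t ∘ φ_p` of `S^m \ {p}`,
where `s_t` is the scaling of `L_p` by `t`. -/
noncomputable def xi {m : ℕ} (p : EuclideanSpace ℝ (Fin (m + 1))) (t : ℝ)
    (q : EuclideanSpace ℝ (Fin (m + 1))) : EuclideanSpace ℝ (Fin (m + 1)) :=
  stereoInvFormula p (t • stereoProj p q)

theorem aux_lt {m : ℕ} {p q : EuclideanSpace ℝ (Fin (m + 1))} (hp : ‖p‖ = 1)
    (hq : ‖q‖ = 1) (hne : q ≠ p) : ⟪q, p⟫ < 1 :=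
  (inner_lt_one_iff_real_of_norm_eq_one hq hp).2 hne

theorem aux_orth {m : ℕ} {p q : EuclideanSpace ℝ (Fin (m + 1))} (hp : ‖p‖ = 1) :
    ⟪stereoProj p q, p⟫ = 0 := by
  simp [stereoProj, inner_smul_left, inner_sub_left, real_inner_self_eq_norm_sq, hp]

theorem aux_norm {m : ℕ} {p q : EuclideanSpace ℝ (Fin (m + 1))} (hp : ‖p‖ = 1)
    (hq : ‖q‖ = 1) (hne : q ≠ p) :
    ‖stereoProj p q‖ ^ 2 = (1 + ⟪q, p⟫) / (1 - ⟪q, p⟫) := by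
  have h := aux_lt hp hq hne
  have h1 : 1 - ⟪q, p⟫ ≠ 0 := by linarith
  rw [stereoProj, norm_smul, mul_pow, norm_sub_sq_real, norm_smul, inner_smul_right, hp, hq]
  simp only [Real.norm_eq_abs, sq_abs, mul_one]
  field_simp
  ring

theorem aux_inv_inner {m : ℕ} {p v : EuclideanSpace ℝ (Fin (m + 1))} (hp : ‖p‖ = 1)
    (hv : ⟪v, p⟫ = 0) :
    ⟪stereoInvFormula p v, p⟫ = (‖v‖ ^ 2 - 1) / (‖v‖ ^ 2 + 1) := by
  rw [stereoInvFormula, inner_smul_left, inner_add_left, inner_smul_left, inner_smul_left, hv,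
    real_inner_self_eq_norm_sq, hp]
  simp
  ring

theorem aux_inv_norm {m : ℕ} {p v : EuclideanSpace ℝ (Fin (m + 1))} (hp : ‖p‖ = 1)
    (hv : ⟪v, p⟫ = 0) : ‖stereoInvFormula p v‖ = 1 := by
  have h1 : ‖v‖ ^ 2 + 1 ≠ 0 := by positivity
  have : ‖stereoInvFormula p v‖ ^ 2 = 1 := by
    rw [stereoInvFormula, norm_smul, mul_pow, norm_add_sq_real, norm_smul, norm_smul,
      inner_smul_right, inner_smul_left, real_inner_comm, hv, hp]
    simp only [Real.norm_eq_abs, sq_abs, mul_one, mul_pow]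
    field_simp
    norm_num
    ring
  have h0 := norm_nonneg (stereoInvFormula p v)
  nlinarith

theorem aux_inv_ne {m : ℕ} {p v : EuclideanSpace ℝ (Fin (m + 1))} (hp : ‖p‖ = 1)
    (hv : ⟪v, p⟫ = 0) : stereoInvFormula p v ≠ p := by
  intro h
  have h2 := aux_inv_inner hp hv
  have h1 : ‖v‖ ^ 2 + 1 ≠ 0 := by positivity
  rw [h, real_inner_self_eq_norm_sq, hp] at h2
  field_simp at h2
  linarith

theorem aux_proj_inv {m : ℕ} {p v : EuclideanSpace ℝ (Fin (m + 1))} (hp : ‖p‖ = 1)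
    (hv : ⟪v, p⟫ = 0) : stereoProj p (stereoInvFormula p v) = v := by
  have h1 : ‖v‖ ^ 2 + 1 ≠ 0 := by positivity
  have h2 : (1 - (‖v‖ ^ 2 - 1) / (‖v‖ ^ 2 + 1))⁻¹ = (‖v‖ ^ 2 + 1) / 2 := by
    rw [inv_eq_iff_eq_inv, inv_div]
    field_simp
    ring
  rw [stereoProj, aux_inv_inner hp hv, h2, stereoInvFormula]
  match_scalars <;> field_simp <;> ring

theorem aux_inv_proj {m : ℕ} {p q : EuclideanSpace ℝ (Fin (m + 1))} (hp : ‖p‖ = 1)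
    (hq : ‖q‖ = 1) (hne : q ≠ p) : stereoInvFormula p (stereoProj p q) = q := by
  have h := aux_lt hp hq hne
  have h1 : 1 - ⟪q, p⟫ ≠ 0 := by linarith
  have h2 : ((1 + ⟪q, p⟫) / (1 - ⟪q, p⟫) + 1)⁻¹ = (1 - ⟪q, p⟫) / 2 := by
    rw [inv_eq_iff_eq_inv, inv_div]
    field_simp
    ring
  rw [stereoInvFormula, aux_norm hp hq hne, h2, stereoProj]
  match_scalars <;> field_simp <;> ring

theorem aux_orth_smul {m : ℕ} {p q : EuclideanSpace ℝ (Fin (m + 1))} (hp : ‖p‖ = 1) (t : ℝ) :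
    ⟪t • stereoProj p q, p⟫ = 0 := by
  rw [inner_smul_left, aux_orth hp, mul_zero]

theorem aux_xi_xi {m : ℕ} {p q : EuclideanSpace ℝ (Fin (m + 1))} (hp : ‖p‖ = 1)
    (hq : ‖q‖ = 1) (hne : q ≠ p) {s t : ℝ} (hst : s * t = 1) : xi p s (xi p t q) = q := by
  rw [xi, xi, aux_proj_inv hp (aux_orth_smul hp t), smul_smul, hst, one_smul,
    aux_inv_proj hp hq hne]

theorem aux_xi_inner {m : ℕ} {p q : EuclideanSpace ℝ (Fin (m + 1))} (hp : ‖p‖ = 1)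
    (hq : ‖q‖ = 1) (hne : q ≠ p) (t : ℝ) :
    ⟪xi p t q, p⟫ = (t ^ 2 * (1 + ⟪q, p⟫) - (1 - ⟪q, p⟫)) /
      (t ^ 2 * (1 + ⟪q, p⟫) + (1 - ⟪q, p⟫)) := by
  have h := aux_lt hp hq hne
  have h0 : -1 ≤ ⟪q, p⟫ := by
    have := neg_le_of_abs_le (abs_real_inner_le_norm q p)
    rwa [hp, hq, mul_one] at this
  have h1 : 0 < 1 - ⟪q, p⟫ := by linarith
  have h2 : 0 ≤ t ^ 2 * (1 + ⟪q, p⟫) := mul_nonneg (sq_nonneg _) (by linarith)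
  rw [xi, aux_inv_inner hp (aux_orth_smul hp t), norm_smul, mul_pow, aux_norm hp hq hne]
  simp only [Real.norm_eq_abs, sq_abs]
  have h3 : t ^ 2 * (1 + ⟪q, p⟫) + (1 - ⟪q, p⟫) ≠ 0 := by linarith
  have h4 : t ^ 2 * ((1 + ⟪q, p⟫) / (1 - ⟪q, p⟫)) + 1 ≠ 0 := by
    have : 0 ≤ t ^ 2 * ((1 + ⟪q, p⟫) / (1 - ⟪q, p⟫)) := by
      rw [← mul_div_assoc]; exact div_nonneg h2 h1.le
    linarith
  rw [div_eq_div_iff h4 h3]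
  field_simp

theorem aux_ball {R c : ℝ} (hR : R ∈ Set.Ioo 0 (π / 2)) (hc : -1 ≤ c) (hc' : c ≤ 1) :
    Real.arccos c < 2 * R ↔ 1 - c < Real.tan R ^ 2 * (1 + c) := by
  have h1 : Real.arccos c < 2 * R ↔ Real.cos (2 * R) < c := by
    have hx : 2 * R ∈ Set.Icc 0 π := ⟨by linarith [hR.1], by linarith [hR.2]⟩
    have := Real.strictAntiOn_cos.lt_iff_gt hx ⟨Real.arccos_nonneg c, Real.arccos_le_pi c⟩
    rw [Real.cos_arccos hc hc'] at this
    exact this.symm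
  have hcos : 0 < Real.cos R := Real.cos_pos_of_mem_Ioo ⟨by linarith [hR.1, hR.2], hR.2⟩
  have hs := Real.sin_sq_add_cos_sq R
  rw [h1, Real.tan_eq_sin_div_cos, div_pow, div_mul_eq_mul_div, lt_div_iff₀ (by positivity),
    Real.cos_two_mul, show Real.sin R ^ 2 = 1 - Real.cos R ^ 2 by linarith]
  constructor <;> intro h <;> nlinarith

/-- For `R ∈ (0, π/2)`, the map `ξ_{p, tan R}` sends the punctured geodesic ball
`B_{2R}(p) \ {p}` bijectively onto the punctured open hemisphere
`{x ∈ S^m : ⟪x,p⟫ > 0} \ {p}` centred at `p`. -/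
theorem stmt7 (m : ℕ) (p : EuclideanSpace ℝ (Fin (m + 1))) (hp : ‖p‖ = 1)
    (R : ℝ) (hR : R ∈ Set.Ioo 0 (π / 2)) :
    Set.BijOn (xi p (Real.tan R))
      {q : EuclideanSpace ℝ (Fin (m + 1)) | ‖q‖ = 1 ∧ q ≠ p ∧ Real.arccos ⟪p, q⟫ < 2 * R}
      {x : EuclideanSpace ℝ (Fin (m + 1)) | ‖x‖ = 1 ∧ 0 < ⟪x, p⟫ ∧ x ≠ p} := by
  have ht : 0 < Real.tan R := Real.tan_pos_of_pos_of_lt_pi_div_two hR.1 hR.2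
  have hb : ∀ q : EuclideanSpace ℝ (Fin (m + 1)), ‖q‖ = 1 → -1 ≤ ⟪q, p⟫ := by
    intro q hq
    have := neg_le_of_abs_le (abs_real_inner_le_norm q p)
    rwa [hp, hq, mul_one] at this
  refine Set.InvOn.bijOn (f' := xi p (Real.tan R)⁻¹) ⟨?_, ?_⟩ ?_ ?_
  · rintro q ⟨hq, hne, -⟩
    exact aux_xi_xi hp hq hne (inv_mul_cancel₀ ht.ne')
  · rintro q ⟨hq, -, hne⟩
    exact aux_xi_xi hp hq hne (mul_inv_cancel₀ ht.ne')
  · rintro q ⟨hq, hne, hd⟩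
    have hl := aux_lt hp hq hne
    rw [real_inner_comm, aux_ball hR (hb q hq) hl.le] at hd
    refine ⟨aux_inv_norm hp (aux_orth_smul hp _), ?_, aux_inv_ne hp (aux_orth_smul hp _)⟩
    rw [aux_xi_inner hp hq hne]
    apply div_pos <;> linarith
  · rintro q ⟨hq, hpos, hne⟩
    have hl := aux_lt hp hq hne
    have hn : ‖xi p (Real.tan R)⁻¹ q‖ = 1 := aux_inv_norm hp (aux_orth_smul hp _)
    have hne' : xi p (Real.tan R)⁻¹ q ≠ p := aux_inv_ne hp (aux_orth_smul hp _)
    refine ⟨hn, hne', ?_⟩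
    have hl' := aux_lt hp hn hne'
    have hi := aux_xi_inner hp (q := xi p (Real.tan R)⁻¹ q) hn hne' (Real.tan R)
    rw [aux_xi_xi hp hq hne (mul_inv_cancel₀ ht.ne')] at hi
    rw [real_inner_comm, aux_ball hR (hb _ hn) hl'.le]
    have h2 : 0 ≤ Real.tan R ^ 2 * (1 + ⟪xi p (Real.tan R)⁻¹ q, p⟫) :=
      mul_nonneg (sq_nonneg _) (by linarith [hb _ hn])
    rw [hi] at hpos
    have := (div_pos_iff_of_pos_right (by linarith)).1 hpos
    linarith
end

section
/- For every R ∈ (0, π/2), every p ∈ S^m, and every q ∈ S^m with q ≠ p and geodesic distance d(p,q) < R (equivalently ⟨p,q⟩ > cos R), one has ⟨ξ_{p, tan R}(q), p⟩ ≥ 3/5. In other words, the test function φ_{R,p} satisfies φ_{R,p}(q) ≥ 3/5 for every q in the geodesic ball B_R(p). -/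
open Real
open scoped RealInnerProductSpace

open scoped Classical in
/-- The test function `φ_{R,p} : S^m → ℝ`: `φ_{R,p}(q) = ⟪ξ_{p,tan R}(q), p⟫` for
`0 < d(p,q) < 2R`, `φ_{R,p}(p) = 1`, and `φ_{R,p}(q) = 0` for `d(p,q) ≥ 2R`. -/
noncomputable def phiTest {m : ℕ} (R : ℝ) (p q : EuclideanSpace ℝ (Fin (m + 1))) : ℝ :=
  if q = p then 1
  else if Real.arccos ⟪p, q⟫ < 2 * R then ⟪xi p (Real.tan R) q, p⟫
  else 0

theorem key_aux (m : ℕ) (p : EuclideanSpace ℝ (Fin (m + 1))) (hp : ‖p‖ = 1)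
    (R : ℝ) (hR : R ∈ Set.Ioo 0 (π / 2)) (q : EuclideanSpace ℝ (Fin (m + 1))) (hq : ‖q‖ = 1)
    (hne : q ≠ p) (hd : Real.arccos ⟪p, q⟫ < R) :
    (3 / 5 : ℝ) ≤ ⟪xi p (Real.tan R) q, p⟫ := by
  obtain ⟨h0, h1⟩ := hR
  have hC0 : 0 < Real.cos R := Real.cos_pos_of_mem_Ioo ⟨by linarith, h1⟩
  have hC1 : Real.cos R ≤ 1 := Real.cos_le_one R
  have hpp : ⟪p, p⟫ = (1 : ℝ) := by rw [real_inner_self_eq_norm_sq, hp]; norm_num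
  have hqq : ⟪q, q⟫ = (1 : ℝ) := by rw [real_inner_self_eq_norm_sq, hq]; norm_num
  have hc1 : ⟪q, p⟫ < (1 : ℝ) := (inner_lt_one_iff_real_of_norm_eq_one hq hp).2 hne
  have hcl : (-1 : ℝ) ≤ ⟪q, p⟫ := by
    have := neg_le_of_abs_le (abs_real_inner_le_norm q p)
    rw [hp, hq] at this; linarith
  have hcC : Real.cos R < ⟪q, p⟫ := by
    rw [real_inner_comm] at hd
    have := Real.cos_lt_cos_of_nonneg_of_le_pi (Real.arccos_nonneg _) (by linarith) hd
    rwa [Real.cos_arccos hcl hc1.le] at this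
  have hT : Real.tan R ^ 2 * Real.cos R ^ 2 = 1 - Real.cos R ^ 2 := by
    rw [← mul_pow, Real.tan_mul_cos hC0.ne', Real.sin_sq]
  have hvp : ⟪Real.tan R • stereoProj p q, p⟫ = (0 : ℝ) := by
    simp only [stereoProj, inner_smul_left, inner_sub_left, hpp]
    simp
  have hvv : ‖Real.tan R • stereoProj p q‖ ^ 2 * (1 - ⟪q, p⟫) = Real.tan R ^ 2 * (1 + ⟪q, p⟫) := by
    rw [← real_inner_self_eq_norm_sq]
    have hpq : ⟪p, q⟫ = ⟪q, p⟫ := real_inner_comm _ _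
    simp only [stereoProj, inner_smul_left, inner_smul_right, inner_sub_left, inner_sub_right,
      hpp, hqq, hpq]
    have : (1 - ⟪q, p⟫ : ℝ) ≠ 0 := by linarith
    simp only [conj_trivial]
    field_simp
    ring
  unfold xi stereoInvFormula
  rw [inner_smul_left, inner_add_left, inner_smul_left, inner_smul_left, hvp, hpp]
  generalize ‖Real.tan R • stereoProj p q‖ ^ 2 = s at *
  generalize (⟪q, p⟫ : ℝ) = c at *
  generalize Real.cos R = C at *
  generalize Real.tan R = T at *
  have hs : 4 ≤ s := by
    have e : (s - 4) * ((1 - c) * C ^ 2) = (1 - C ^ 2) * (1 + c) - 4 * C ^ 2 * (1 - c) := by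
      linear_combination C ^ 2 * hvv + (1 + c) * hT
    have e2 : 0 ≤ (s - 4) * ((1 - c) * C ^ 2) := by
      rw [e]
      have a1 : 0 ≤ (1 - C ^ 2) * (c - C) := mul_nonneg (by nlinarith) (by linarith)
      have a2 : 0 ≤ C ^ 2 * (c - C) := mul_nonneg (by positivity) (by linarith)
      have a3 : 0 ≤ (1 - C) * ((1 - C) * (1 + 3 * C)) :=
        mul_nonneg (by linarith) (mul_nonneg (by linarith) (by linarith))
      linarith
    have e3 : 0 < (1 - c) * C ^ 2 := mul_pos (by linarith) (by positivity)
    linarith [nonneg_of_mul_nonneg_left e2 e3]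
  simp only [conj_trivial]
  rw [inv_mul_eq_div, le_div_iff₀ (by linarith)]
  linarith

/-- For `R ∈ (0, π/2)` and `q ∈ S^m` with `q ≠ p` and `d(p,q) < R`, one has
`⟪ξ_{p,tan R}(q), p⟫ ≥ 3/5`; in other words, `φ_{R,p} ≥ 3/5` on the geodesic ball `B_R(p)`. -/
theorem stmt8 (m : ℕ) (p : EuclideanSpace ℝ (Fin (m + 1))) (hp : ‖p‖ = 1)
    (R : ℝ) (hR : R ∈ Set.Ioo 0 (π / 2)) :
    (∀ q : EuclideanSpace ℝ (Fin (m + 1)), ‖q‖ = 1 → q ≠ p →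
      Real.arccos ⟪p, q⟫ < R → (3 / 5 : ℝ) ≤ ⟪xi p (Real.tan R) q, p⟫) ∧
    (∀ q : EuclideanSpace ℝ (Fin (m + 1)), ‖q‖ = 1 →
      Real.arccos ⟪p, q⟫ < R → (3 / 5 : ℝ) ≤ phiTest R p q) := by
  refine ⟨fun q hq hne hd => key_aux m p hp R hR q hq hne hd, fun q hq hd => ?_⟩
  unfold phiTest
  split_ifs with h1 h2
  · norm_num
  · exact key_aux m p hp R hR q hq h1 hd
  · exact absurd (by linarith [hR.1]) h2
end

section
/- For every r ∈ (0, π), every p ∈ S^m, and every q ∈ S^m with geodesic distance d(p,q) ≥ r (equivalently ⟨p,q⟩ ≤ cos r), one has ⟨ξ_{p, tan(r/4)}(q), p⟩ ≤ −3/5. In other words, the test function φ̄_{r,p} satisfies φ̄_{r,p}(q) ≥ 3/5 for every q outside the geodesic ball B_r(p). -/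
open Real
open scoped RealInnerProductSpace

open scoped Classical in
/-- The test function `φ̄_{r,p} : S^m → ℝ`: `φ̄_{r,p}(q) = 0` for `d(p,q) ≤ r/2` and
`φ̄_{r,p}(q) = −⟪ξ_{p,tan(r/4)}(q), p⟫` for `d(p,q) ≥ r/2` (the two formulas agree
when `d(p,q) = r/2`). -/
noncomputable def phiBarTest {m : ℕ} (r : ℝ) (p q : EuclideanSpace ℝ (Fin (m + 1))) : ℝ :=
  if Real.arccos ⟪p, q⟫ ≤ r / 2 then 0
  else -⟪xi p (Real.tan (r / 4)) q, p⟫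

/-- For `r ∈ (0, π)` and `q ∈ S^m` with `d(p,q) ≥ r`, one has
`⟪ξ_{p,tan(r/4)}(q), p⟫ ≤ −3/5`; in other words, `φ̄_{r,p} ≥ 3/5` outside the
geodesic ball `B_r(p)`. -/
theorem stmt9 (m : ℕ) (p : EuclideanSpace ℝ (Fin (m + 1))) (hp : ‖p‖ = 1)
    (r : ℝ) (hr : r ∈ Set.Ioo 0 π)
    (q : EuclideanSpace ℝ (Fin (m + 1))) (hq : ‖q‖ = 1)
    (hd : r ≤ Real.arccos ⟪p, q⟫) :
    ⟪xi p (Real.tan (r / 4)) q, p⟫ ≤ -(3 / 5 : ℝ) ∧ (3 / 5 : ℝ) ≤ phiBarTest r p q := by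
  have hpi := Real.pi_pos
  obtain ⟨hr0, hr1⟩ := hr
  have hpp : ⟪p, p⟫ = (1 : ℝ) := by rw [real_inner_self_eq_norm_sq, hp]; norm_num
  have hqq : ⟪q, q⟫ = (1 : ℝ) := by rw [real_inner_self_eq_norm_sq, hq]; norm_num
  have hpq : ⟪p, q⟫ = ⟪q, p⟫ := real_inner_comm _ _
  have habs : |⟪p, q⟫| ≤ 1 := by
    have := abs_real_inner_le_norm p q
    rwa [hp, hq, one_mul] at this
  have hc1 : -1 ≤ ⟪p, q⟫ := (abs_le.mp habs).1
  have hc2 : ⟪p, q⟫ ≤ 1 := (abs_le.mp habs).2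
  have hcr : ⟪p, q⟫ ≤ Real.cos r := by
    rw [← Real.cos_arccos hc1 hc2]
    exact Real.cos_le_cos_of_nonneg_of_le_pi hr0.le (Real.arccos_le_pi _) hd
  have hd0 : 0 < Real.cos (r / 2) :=
    Real.cos_pos_of_mem_Ioo ⟨by linarith, by linarith⟩
  have hd1 : Real.cos (r / 2) < 1 := by
    rw [← Real.cos_zero]
    exact Real.cos_lt_cos_of_nonneg_of_le_pi le_rfl (by linarith) (by linarith)
  have ha0 : 0 < Real.cos (r / 4) :=
    Real.cos_pos_of_mem_Ioo ⟨by linarith, by linarith⟩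
  have hda : Real.cos (r / 2) = 2 * Real.cos (r / 4) ^ 2 - 1 := by
    rw [← Real.cos_two_mul]; ring_nf
  have hcd : Real.cos r = 2 * Real.cos (r / 2) ^ 2 - 1 := by
    rw [← Real.cos_two_mul]; ring_nf
  have ht : Real.tan (r / 4) ^ 2 * (1 + Real.cos (r / 2)) = 1 - Real.cos (r / 2) := by
    rw [Real.tan_eq_sin_div_cos, div_pow, Real.sin_sq, hda]
    field_simp
    ring
  rw [hpq] at hc1 hc2 hcr
  set d := Real.cos (r / 2) with hdd
  set c : ℝ := ⟪q, p⟫ with hc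
  set t := Real.tan (r / 4) with htt
  have hclt : 0 < 1 - c := by nlinarith
  have hN : ‖t • stereoProj p q‖ ^ 2 * (1 - c) = t ^ 2 * (1 + c) := by
    have h1 : ‖q - c • p‖ ^ 2 = 1 - c ^ 2 := by
      rw [norm_sub_sq_real, norm_smul, inner_smul_right, ← hc, hp, hq, mul_one,
        Real.norm_eq_abs, sq_abs]
      ring
    unfold stereoProj
    rw [← hc, norm_smul, norm_smul, mul_pow, mul_pow, h1, Real.norm_eq_abs, Real.norm_eq_abs,
      sq_abs, sq_abs]
    field_simp
    ring
  have hperp : ⟪t • stereoProj p q, p⟫ = (0 : ℝ) := by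
    unfold stereoProj
    rw [← hc, real_inner_smul_left, real_inner_smul_left, inner_sub_left, real_inner_smul_left,
      hpp, ← hc]
    ring
  have hxi : ⟪xi p t q, p⟫ =
      (‖t • stereoProj p q‖ ^ 2 + 1)⁻¹ * (‖t • stereoProj p q‖ ^ 2 - 1) := by
    unfold xi stereoInvFormula
    rw [real_inner_smul_left, inner_add_left, real_inner_smul_left, real_inner_smul_left,
      hperp, hpp]
    ring
  have hN0 : 0 ≤ ‖t • stereoProj p q‖ ^ 2 := by positivity
  have hN4 : ‖t • stereoProj p q‖ ^ 2 ≤ 1 / 4 := by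
    generalize ‖t • stereoProj p q‖ ^ 2 = N at hN hN0
    have hk : 4 * (1 - d) * (1 + c) ≤ (1 + d) * (1 - c) := by
      nlinarith [mul_nonneg (mul_nonneg hd0.le hd0.le) (sub_nonneg.mpr hd1.le),
        mul_le_mul_of_nonneg_left hcr (by linarith : (0 : ℝ) ≤ 5 - 3 * d),
        mul_nonneg (sub_nonneg.mpr hd1.le) (by nlinarith : (0 : ℝ) ≤ 1 + 2 * d - 3 * d ^ 2)]
    have h2 : N * ((1 - c) * (1 + d)) = (1 - d) * (1 + c) := by
      rw [← ht]; linear_combination (1 + d) * hN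
    have h3 : 0 < (1 - c) * (1 + d) := by positivity
    by_contra hcon
    push Not at hcon
    nlinarith [mul_lt_mul_of_pos_right hcon h3]
  have hmain : ⟪xi p t q, p⟫ ≤ -(3 / 5 : ℝ) := by
    rw [hxi, inv_mul_le_iff₀ (by positivity)]
    linarith
  refine ⟨hmain, ?_⟩
  unfold phiBarTest
  rw [if_neg (by linarith)]
  linarith
end

section
/- For every p ∈ S^m and every R ∈ (0, π/2), the function φ_{R,p} : S^m → ℝ is Lipschitz continuous (with respect to the Euclidean distance of ℝ^{m+1} restricted to S^m), takes values in [0,1], and vanishes identically outside the geodesic ball B_{2R}(p). -/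
open Real
open scoped RealInnerProductSpace

/-- the profile -/
noncomputable def gProf (t u : ℝ) : ℝ :=
  ((1 + t ^ 2) * u - (1 - t ^ 2)) / ((1 + t ^ 2) - (1 - t ^ 2) * u)

theorem den_pos_aux (t u : ℝ) (ht : 0 < t) (h1 : -1 ≤ u) (h2 : u ≤ 1) :
    2 * min 1 (t ^ 2) ≤ (1 + t ^ 2) - (1 - t ^ 2) * u := by
  rcases le_total 1 (t ^ 2) with h | h
  · rw [min_eq_left h]; nlinarith
  · rw [min_eq_right h]; nlinarith

theorem inner_xi_aux {m : ℕ} (p q : EuclideanSpace ℝ (Fin (m + 1))) (hp : ‖p‖ = 1)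
    (hq : ‖q‖ = 1) (t : ℝ) (ht : 0 < t) (hlt : ⟪q, p⟫ < 1) (hge : -1 ≤ ⟪q, p⟫) :
    ⟪xi p t q, p⟫ = gProf t ⟪q, p⟫ := by
  have hpp : ⟪p, p⟫ = (1 : ℝ) := by rw [real_inner_self_eq_norm_sq, hp]; norm_num
  have hqq : ⟪q, q⟫ = (1 : ℝ) := by rw [real_inner_self_eq_norm_sq, hq]; norm_num
  have hpq : ⟪p, q⟫ = ⟪q, p⟫ := real_inner_comm _ _
  set u : ℝ := ⟪q, p⟫ with hu
  have hne : 1 - u ≠ 0 := by linarith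
  have hn : ‖t • stereoProj p q‖ ^ 2 = t ^ 2 * (1 + u) / (1 - u) := by
    rw [← real_inner_self_eq_norm_sq]
    simp only [stereoProj, inner_smul_left, inner_smul_right, inner_sub_left, inner_sub_right,
      hpp, hqq, hpq, ← hu, conj_trivial]
    field_simp
    ring
  have ho : ⟪t • stereoProj p q, p⟫ = (0 : ℝ) := by
    simp only [stereoProj, inner_smul_left, inner_sub_left, hpp, ← hu, conj_trivial]
    ring
  rw [xi, stereoInvFormula, hn, inner_smul_left, inner_add_left, inner_smul_left, inner_smul_left,
    ho, hpp, gProf]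
  simp only [conj_trivial]
  have hd := den_pos_aux t u ht hge hlt.le
  have hm : 0 < min 1 (t ^ 2) := by positivity
  have hd1 : (1 + t ^ 2) - (1 - t ^ 2) * u ≠ 0 := by linarith
  have hd2 : t ^ 2 * (1 + u) / (1 - u) + 1 ≠ 0 := by
    have : t ^ 2 * (1 + u) / (1 - u) + 1 = ((1 + t ^ 2) - (1 - t ^ 2) * u) / (1 - u) := by
      field_simp; ring
    rw [this]; exact div_ne_zero hd1 hne
  rw [inv_mul_eq_div, div_eq_div_iff hd2 hd1]
  field_simp
  ring

theorem phi_eq_aux {m : ℕ} (p q : EuclideanSpace ℝ (Fin (m + 1))) (hp : ‖p‖ = 1)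
    (hq : ‖q‖ = 1) (R : ℝ) (hR : R ∈ Set.Ioo 0 (π / 2)) :
    phiTest R p q = max 0 (gProf (tan R) ⟪q, p⟫) := by
  obtain ⟨h0, h1⟩ := hR
  have ht : 0 < tan R := tan_pos_of_pos_of_lt_pi_div_two h0 h1
  have hc : 0 < cos R := cos_pos_of_mem_Ioo ⟨by linarith, h1⟩
  have habs := abs_le.1 ((abs_real_inner_le_norm q p).trans (by rw [hp, hq]; norm_num : ‖q‖ * ‖p‖ ≤ 1))
  have hd := den_pos_aux (tan R) ⟪q, p⟫ ht habs.1 habs.2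
  have hm : 0 < min 1 (tan R ^ 2) := by positivity
  have hcos : (1 + tan R ^ 2) * cos (2 * R) = 1 - tan R ^ 2 := by
    rw [cos_two_mul, tan_eq_sin_div_cos]
    field_simp
    have := sin_sq_add_cos_sq R
    rw [add_comm (cos R ^ 2), this]; linarith
  have key : Real.arccos ⟪p, q⟫ < 2 * R ↔ cos (2 * R) < ⟪q, p⟫ := by
    rw [real_inner_comm q p]
    conv_lhs => rw [← Real.arccos_cos (x := 2 * R) (by linarith) (by linarith)]
    exact Real.strictAntiOn_arccos.lt_iff_gt habs ⟨neg_one_le_cos _, cos_le_one _⟩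
  rw [phiTest]
  split_ifs with h h'
  · subst h
    have : ⟪q, q⟫ = (1 : ℝ) := by rw [real_inner_self_eq_norm_sq, hp]; norm_num
    have hg : gProf (tan R) ⟪q, q⟫ = 1 := by
      rw [this, gProf]
      have : tan R ≠ 0 := ht.ne'
      rw [div_eq_one_iff_eq (by ring_nf; positivity)]; ring
    rw [hg]; norm_num
  · rw [key] at h'
    have hlt : ⟪q, p⟫ < (1 : ℝ) := lt_of_le_of_ne habs.2
      (fun e => h ((inner_eq_one_iff_of_norm_eq_one hq hp).1 e))
    rw [inner_xi_aux p q hp hq _ ht hlt habs.1, max_eq_right]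
    apply div_nonneg _ (by linarith)
    nlinarith [sq_nonneg (tan R)]
  · rw [key, not_lt] at h'
    rw [max_eq_left]
    apply div_nonpos_of_nonpos_of_nonneg _ (by linarith)
    nlinarith [sq_nonneg (tan R)]

/-- For `R ∈ (0, π/2)`, the function `φ_{R,p} : S^m → ℝ` is Lipschitz continuous with
respect to the Euclidean distance of `ℝ^{m+1}` restricted to `S^m`, takes values in
`[0,1]`, and vanishes identically outside the geodesic ball `B_{2R}(p)`. -/
theorem stmt10 (m : ℕ) (p : EuclideanSpace ℝ (Fin (m + 1))) (hp : ‖p‖ = 1)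
    (R : ℝ) (hR : R ∈ Set.Ioo 0 (π / 2)) :
    (∃ K : NNReal, LipschitzOnWith K (phiTest R p)
      {q : EuclideanSpace ℝ (Fin (m + 1)) | ‖q‖ = 1}) ∧
    (∀ q : EuclideanSpace ℝ (Fin (m + 1)), ‖q‖ = 1 →
      phiTest R p q ∈ Set.Icc (0 : ℝ) 1) ∧
    (∀ q : EuclideanSpace ℝ (Fin (m + 1)), ‖q‖ = 1 →
      2 * R ≤ Real.arccos ⟪p, q⟫ → phiTest R p q = 0) := by
  have ht : 0 < tan R := tan_pos_of_pos_of_lt_pi_div_two hR.1 hR.2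
  have hm : 0 < min 1 (tan R ^ 2) := by positivity
  have hab : ∀ q : EuclideanSpace ℝ (Fin (m + 1)), ‖q‖ = 1 → -1 ≤ ⟪q, p⟫ ∧ ⟪q, p⟫ ≤ (1 : ℝ) :=
    fun q hq => abs_le.1
      ((abs_real_inner_le_norm q p).trans (by rw [hp, hq]; norm_num : ‖q‖ * ‖p‖ ≤ 1))
  refine ⟨?_, ?_, ?_⟩
  · set t := tan R with htt
    set c := 2 * min 1 (t ^ 2) with hcc
    have hc : 0 < c := by positivity
    refine ⟨NNReal.mk (4 * t ^ 2 / c ^ 2) (by positivity), LipschitzOnWith.of_dist_le_mul ?_⟩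
    intro x hx y hy
    have hx' : ‖x‖ = 1 := hx
    have hy' : ‖y‖ = 1 := hy
    rw [phi_eq_aux p x hp hx' R hR, phi_eq_aux p y hp hy' R hR, Real.dist_eq, ← htt]
    have dx := den_pos_aux t _ ht (hab x hx').1 (hab x hx').2
    have dy := den_pos_aux t _ ht (hab y hy').1 (hab y hy').2
    rw [← hcc] at dx dy
    have hin : |⟪x, p⟫ - ⟪y, p⟫| ≤ dist x y := by
      rw [← inner_sub_left, dist_eq_norm]
      simpa [hp] using abs_real_inner_le_norm (x - y) p
    have hmax : |max 0 (gProf t ⟪x, p⟫) - max 0 (gProf t ⟪y, p⟫)|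
        ≤ |gProf t ⟪x, p⟫ - gProf t ⟪y, p⟫| := by
      simpa using abs_max_sub_max_le_max 0 (gProf t ⟪x, p⟫) 0 (gProf t ⟪y, p⟫)
    refine hmax.trans ?_
    have hg : gProf t ⟪x, p⟫ - gProf t ⟪y, p⟫ = 4 * t ^ 2 /
        (((1 + t ^ 2) - (1 - t ^ 2) * ⟪x, p⟫) * ((1 + t ^ 2) - (1 - t ^ 2) * ⟪y, p⟫)) *
        (⟪x, p⟫ - ⟪y, p⟫) := by
      have h1 : (1 + t ^ 2) - (1 - t ^ 2) * ⟪x, p⟫ ≠ 0 := by linarith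
      have h2 : (1 + t ^ 2) - (1 - t ^ 2) * ⟪y, p⟫ ≠ 0 := by linarith
      rw [gProf, gProf, div_sub_div _ _ h1 h2, div_mul_eq_mul_div]
      congr 1
      ring
    rw [hg, abs_mul, NNReal.coe_mk]
    have hpos := mul_pos (hc.trans_le dx) (hc.trans_le dy)
    rw [abs_of_nonneg (by positivity)]
    have : c ^ 2 ≤ ((1 + t ^ 2) - (1 - t ^ 2) * ⟪x, p⟫) * ((1 + t ^ 2) - (1 - t ^ 2) * ⟪y, p⟫) := by
      rw [sq]; exact mul_le_mul dx dy hc.le (hc.le.trans dx)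
    gcongr
  · intro q hq
    rw [phi_eq_aux p q hp hq R hR]
    have h := hab q hq
    have hd := den_pos_aux (tan R) _ ht h.1 h.2
    refine ⟨le_max_left _ _, max_le zero_le_one ?_⟩
    rw [gProf, div_le_one (by linarith)]
    nlinarith
  · intro q hq h
    rw [phiTest, if_neg, if_neg (not_lt.2 h)]
    rintro rfl
    rw [real_inner_self_eq_norm_sq, hp] at h
    norm_num at h
    linarith [hR.1]
end

section
/- Let p ∈ S^m, let 0 < r < R < π/2, let A = {q ∈ S^m : r ≤ d(p,q) < R} be the corresponding annulus and 2A = {q ∈ S^m : r/2 ≤ d(p,q) < 2R}. Then the function u_A = φ_{R,p} · φ̄_{r,p} on S^m satisfies: 0 ≤ u_A ≤ 1 everywhere, u_A vanishes identically outside 2A, and u_A(q) ≥ 9/25 for every q ∈ A. -/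
open Real
open scoped RealInnerProductSpace

lemma aux_xi {m : ℕ} (p q : EuclideanSpace ℝ (Fin (m + 1))) (hp : ‖p‖ = 1) (hq : ‖q‖ = 1)
    (a : ℝ) (ha : Real.cos a ≠ 0) (hc : ⟪p, q⟫ < 1)
    (hd : 0 < 1 - ⟪p, q⟫ * Real.cos (2 * a)) :
    ⟪xi p (Real.tan a) q, p⟫ =
      (⟪p, q⟫ - Real.cos (2 * a)) / (1 - ⟪p, q⟫ * Real.cos (2 * a)) := by
  have hpp : ⟪p, p⟫ = 1 := by rw [real_inner_self_eq_norm_sq, hp]; norm_num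
  have hqq : ⟪q, q⟫ = 1 := by rw [real_inner_self_eq_norm_sq, hq]; norm_num
  have hqp : ⟪q, p⟫ = ⟪p, q⟫ := real_inner_comm _ _
  obtain ⟨c, hcdef⟩ : ∃ c, c = ⟪p, q⟫ := ⟨_, rfl⟩
  rw [← hcdef] at hc hd hqp ⊢
  have h1 : (1 - c) ≠ 0 := by linarith
  have hv : ⟪stereoProj p q, p⟫ = 0 := by
    simp only [stereoProj, inner_smul_left, inner_sub_left, hqp, hpp]
    simp
  have hn : ‖stereoProj p q‖ ^ 2 = (1 + c) / (1 - c) := by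
    rw [← real_inner_self_eq_norm_sq]
    simp only [stereoProj, inner_smul_left, inner_smul_right, inner_sub_left, inner_sub_right,
      hqp, hpp, hqq, ← hcdef]
    simp
    field_simp
    ring
  have hN : ‖Real.tan a • stereoProj p q‖ ^ 2 = Real.tan a ^ 2 * ((1 + c) / (1 - c)) := by
    rw [norm_smul, mul_pow, hn]; simp
  have hx : ⟪xi p (Real.tan a) q, p⟫ =
      (Real.tan a ^ 2 * ((1 + c) / (1 - c)) + 1)⁻¹ *
        (Real.tan a ^ 2 * ((1 + c) / (1 - c)) - 1) := by
    simp only [xi, stereoInvFormula, hN]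
    simp only [inner_smul_left, inner_add_left, hv, hpp]
    simp
  rw [hx]
  have hs : Real.sin a ^ 2 = 1 - Real.cos a ^ 2 := Real.sin_sq a
  have h2 : Real.tan a ^ 2 * ((1 + c) / (1 - c)) =
      ((1 - Real.cos a ^ 2) * (1 + c)) / (Real.cos a ^ 2 * (1 - c)) := by
    rw [Real.tan_eq_sin_div_cos, div_pow, hs]
    field_simp
  rw [h2]
  rw [Real.cos_two_mul] at hd ⊢
  have hk : Real.cos a ^ 2 * (1 - c) ≠ 0 := mul_ne_zero (pow_ne_zero _ ha) h1
  have hpos : (1 - Real.cos a ^ 2) * (1 + c) / (Real.cos a ^ 2 * (1 - c)) + 1 =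
      (1 - c * (2 * Real.cos a ^ 2 - 1)) / (Real.cos a ^ 2 * (1 - c)) := by
    rw [div_add_one hk]; congr 1; ring
  have hneg : (1 - Real.cos a ^ 2) * (1 + c) / (Real.cos a ^ 2 * (1 - c)) - 1 =
      (c - (2 * Real.cos a ^ 2 - 1)) / (Real.cos a ^ 2 * (1 - c)) := by
    rw [div_sub_one hk]; congr 1; ring
  rw [hpos, hneg, inv_div, div_mul_div_comm, mul_comm (Real.cos a ^ 2 * (1 - c)),
    mul_div_mul_right _ _ hk]

lemma aux_den (c C : ℝ) (h1 : -1 ≤ c) (h2 : c ≤ 1) (h3 : -1 < C) (h4 : C < 1) :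
    0 < 1 - c * C := by
  rcases le_total 0 C with h | h <;> nlinarith

lemma aux_phi {m : ℕ} (p q : EuclideanSpace ℝ (Fin (m + 1))) (hp : ‖p‖ = 1) (hq : ‖q‖ = 1)
    (R : ℝ) (hR0 : 0 < R) (hR : R < π / 2) :
    (0 ≤ phiTest R p q ∧ phiTest R p q ≤ 1) ∧
    (2 * R ≤ Real.arccos ⟪p, q⟫ → phiTest R p q = 0) ∧
    (Real.arccos ⟪p, q⟫ < R → 3 / 5 ≤ phiTest R p q) := by
  have hle : ⟪p, q⟫ ≤ 1 := by simpa [hp, hq] using real_inner_le_norm p q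
  have hge : -1 ≤ ⟪p, q⟫ := by
    have := neg_le_of_abs_le (abs_real_inner_le_norm p q); simpa [hp, hq] using this
  have hcos := Real.cos_arccos hge hle
  have h0 := Real.arccos_nonneg ⟪p, q⟫
  unfold phiTest
  by_cases hqp : q = p
  · subst hqp
    have : ⟪q, q⟫ = 1 := by rw [real_inner_self_eq_norm_sq, hq]; norm_num
    simp only [this, Real.arccos_one, if_true]
    refine ⟨by norm_num, fun h => by linarith, fun _ => by norm_num⟩
  have hc : ⟪p, q⟫ < 1 := lt_of_le_of_ne hle fun h =>
    hqp ((inner_eq_one_iff_of_norm_eq_one hp hq).1 h).symm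
  have hC1 : Real.cos (2 * R) < 1 := by
    have := Real.cos_lt_cos_of_nonneg_of_le_pi (le_refl 0) (by linarith : 2 * R ≤ π) (by linarith)
    simpa using this
  have hC2 : -1 < Real.cos (2 * R) := by
    have := Real.cos_lt_cos_of_nonneg_of_le_pi (by linarith : 0 ≤ 2 * R) le_rfl (by linarith)
    simpa using this
  have hd := aux_den _ _ hge hle hC2 hC1
  have hx : 0 < Real.cos R := Real.cos_pos_of_mem_Ioo ⟨by linarith, hR⟩
  have hx1 : Real.cos R ≤ 1 := Real.cos_le_one R
  rw [if_neg hqp, aux_xi p q hp hq R hx.ne' hc hd]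
  refine ⟨?_, fun h => if_neg (not_lt.2 h), fun h => ?_⟩
  · split_ifs with h
    · have := Real.cos_lt_cos_of_nonneg_of_le_pi h0 (by linarith : 2 * R ≤ π) h
      rw [hcos] at this
      refine ⟨div_nonneg (by linarith) hd.le, (div_le_one hd).2 ?_⟩
      nlinarith
    · norm_num
  · rw [if_pos (by linarith), le_div_iff₀ hd]
    have := Real.cos_lt_cos_of_nonneg_of_le_pi h0 (by linarith : R ≤ π) h
    rw [hcos] at this
    rw [Real.cos_two_mul] at *
    generalize ⟪p, q⟫ = c at *
    generalize Real.cos R = x at *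
    have e1 : 0 ≤ (c - x) * (1 + 3 / 5 * (2 * x ^ 2 - 1)) :=
      mul_nonneg (by linarith) (by nlinarith)
    have e2 : 0 ≤ (1 - x) * ((1 - x) * (2 + 6 * x)) :=
      mul_nonneg (by linarith) (mul_nonneg (by linarith) (by linarith))
    nlinarith

lemma aux_bar {m : ℕ} (p q : EuclideanSpace ℝ (Fin (m + 1))) (hp : ‖p‖ = 1) (hq : ‖q‖ = 1)
    (r : ℝ) (hr0 : 0 < r) (hr : r < π / 2) :
    (0 ≤ phiBarTest r p q ∧ phiBarTest r p q ≤ 1) ∧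
    (Real.arccos ⟪p, q⟫ ≤ r / 2 → phiBarTest r p q = 0) ∧
    (r ≤ Real.arccos ⟪p, q⟫ → 3 / 5 ≤ phiBarTest r p q) := by
  have hle : ⟪p, q⟫ ≤ 1 := by simpa [hp, hq] using real_inner_le_norm p q
  have hge : -1 ≤ ⟪p, q⟫ := by
    have := neg_le_of_abs_le (abs_real_inner_le_norm p q); simpa [hp, hq] using this
  have hcos := Real.cos_arccos hge hle
  have hpi := Real.arccos_le_pi ⟪p, q⟫
  unfold phiBarTest
  by_cases h : Real.arccos ⟪p, q⟫ ≤ r / 2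
  · simp only [if_pos h]
    refine ⟨by norm_num, fun _ => trivial, fun h' => by linarith⟩
  have h' := not_le.1 h
  have hlt := Real.cos_lt_cos_of_nonneg_of_le_pi (by linarith : 0 ≤ r / 2) hpi h'
  rw [hcos] at hlt
  have h2 : 2 * (r / 4) = r / 2 := by ring
  have hy1 : Real.cos (r / 2) < 1 := by
    have := Real.cos_lt_cos_of_nonneg_of_le_pi (le_refl 0) (by linarith : r / 2 ≤ π) (by linarith)
    simpa using this
  have hy0 : 0 < Real.cos (r / 2) := Real.cos_pos_of_mem_Ioo ⟨by linarith, by linarith⟩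
  have hx : 0 < Real.cos (r / 4) := Real.cos_pos_of_mem_Ioo ⟨by linarith, by linarith⟩
  have hd := aux_den _ _ hge hle (by linarith) hy1
  have key := aux_xi p q hp hq (r / 4) hx.ne' (by linarith) (by rw [h2]; exact hd)
  rw [h2] at key
  rw [if_neg h, key, ← neg_div]
  refine ⟨⟨div_nonneg (by linarith) hd.le, (div_le_one hd).2 (by nlinarith)⟩,
    fun h'' => absurd h'' h, fun hrq => ?_⟩
  rw [le_div_iff₀ hd]
  have hh := Real.cos_le_cos_of_nonneg_of_le_pi hr0.le hpi hrq
  rw [hcos, show r = 2 * (r / 2) by ring, Real.cos_two_mul] at hh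
  clear key
  generalize ⟪p, q⟫ = c at *
  generalize Real.cos (r / 2) = y at *
  have e1 : 0 ≤ (2 * y ^ 2 - 1 - c) * (1 - 3 / 5 * y) :=
    mul_nonneg (by linarith) (by linarith)
  have e2 : 0 ≤ (1 - y) * ((1 - y) * (2 + 6 * y)) :=
    mul_nonneg (by linarith) (mul_nonneg (by linarith) (by linarith))
  nlinarith

/-- For `0 < r < R < π/2`, the function `u_A = φ_{R,p}·φ̄_{r,p}` associated with the
annulus `A = {q ∈ S^m : r ≤ d(p,q) < R}` satisfies `0 ≤ u_A ≤ 1` everywhere on `S^m`,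
vanishes identically outside `2A = {q ∈ S^m : r/2 ≤ d(p,q) < 2R}`, and
`u_A ≥ 9/25` on `A`. -/
theorem stmt12 (m : ℕ) (p : EuclideanSpace ℝ (Fin (m + 1))) (hp : ‖p‖ = 1)
    (r R : ℝ) (hr : 0 < r) (hrR : r < R) (hR : R < π / 2) :
    (∀ q : EuclideanSpace ℝ (Fin (m + 1)), ‖q‖ = 1 →
      phiTest R p q * phiBarTest r p q ∈ Set.Icc (0 : ℝ) 1) ∧
    (∀ q : EuclideanSpace ℝ (Fin (m + 1)), ‖q‖ = 1 →
      q ∉ {x : EuclideanSpace ℝ (Fin (m + 1)) |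
        r / 2 ≤ Real.arccos ⟪p, x⟫ ∧ Real.arccos ⟪p, x⟫ < 2 * R} →
      phiTest R p q * phiBarTest r p q = 0) ∧
    (∀ q : EuclideanSpace ℝ (Fin (m + 1)), ‖q‖ = 1 →
      r ≤ Real.arccos ⟪p, q⟫ → Real.arccos ⟪p, q⟫ < R →
      (9 / 25 : ℝ) ≤ phiTest R p q * phiBarTest r p q) := by
  refine ⟨fun q hq => ?_, fun q hq hn => ?_, fun q hq h1 h2 => ?_⟩
  · obtain ⟨⟨a, b⟩, -⟩ := aux_phi p q hp hq R (by linarith) hR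
    obtain ⟨⟨c, d⟩, -⟩ := aux_bar p q hp hq r hr (by linarith)
    exact ⟨mul_nonneg a c, mul_le_one₀ b c d⟩
  · obtain ⟨-, a, -⟩ := aux_phi p q hp hq R (by linarith) hR
    obtain ⟨-, b, -⟩ := aux_bar p q hp hq r hr (by linarith)
    by_cases h : Real.arccos ⟪p, q⟫ ≤ r / 2
    · rw [b h, mul_zero]
    · have : 2 * R ≤ Real.arccos ⟪p, q⟫ := by
        by_contra h3
        exact hn ⟨(not_le.1 h).le, not_le.1 h3⟩
      rw [a this, zero_mul]
  · obtain ⟨-, -, a⟩ := aux_phi p q hp hq R (by linarith) hR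
    obtain ⟨-, -, b⟩ := aux_bar p q hp hq r hr (by linarith)
    have := a h2
    have := b h1
    nlinarith
end
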